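/- Let B be a Bol superalgebra over a field K of characteristic 0 and let b be a supersymmetric bilinear form on B, i.e. b(x,y) = (−1)^{|x||y|} b(y,x) for all homogeneous x,y. Then the following three conditions are equivalent: (i) b([x,y,z],u) = −(−1)^{|z|(|x|+|y|)} b(z,[x,y,u]) for all homogeneous x,y,z,u; (ii) b([x,y,z],u) = −(−1)^{|y|(|z|+|u|)} b(x,[z,u,y]) for all homogeneous x,y,z,u; (iii) b(x,[y,z,u]) = (−1)^{|x||y|+|z||u|} b(y,[x,u,z]) for all homogeneous x,y,z,u. -/

import Mathlib

open LinearMap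

/-- The sign `(-1)^(i·j)` in the ground field, for parities `i j : ZMod 2`. -/
def sgn (K : Type*) [Field K] (i j : ZMod 2) : K := (-1 : K) ^ (i * j).val

/-- A Bol superalgebra over `K`: a `ZMod 2`-graded vector space with a bilinear
product `mul` and a trilinear bracket `tri` satisfying (BS1)–(BS5) on
homogeneous elements. -/
structure BolSuper (K : Type*) (B : Type*) [Field K] [AddCommGroup B] [Module K B] where
  g : ZMod 2 → Submodule K B
  internal : DirectSum.IsInternal g
  mul : B →ₗ[K] B →ₗ[K] B
  tri : B →ₗ[K] B →ₗ[K] B →ₗ[K] B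
  mul_mem : ∀ i j x y, x ∈ g i → y ∈ g j → mul x y ∈ g (i + j)
  tri_mem : ∀ i j k x y z, x ∈ g i → y ∈ g j → z ∈ g k → tri x y z ∈ g (i + j + k)
  bs1 : ∀ i j x y, x ∈ g i → y ∈ g j → mul x y = -(sgn K i j • mul y x)
  bs2 : ∀ i j k x y z, x ∈ g i → y ∈ g j → z ∈ g k → tri x y z = -(sgn K i j • tri y x z)
  bs3 : ∀ i j k x y z, x ∈ g i → y ∈ g j → z ∈ g k →
    tri x y z + sgn K i (j + k) • tri y z x + sgn K k (i + j) • tri z x y = 0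
  bs4 : ∀ i j k l m x y u v w, x ∈ g i → y ∈ g j → u ∈ g k → v ∈ g l → w ∈ g m →
    tri x y (tri u v w) = tri (tri x y u) v w + sgn K k (i + j) • tri u (tri x y v) w
      + sgn K (i + j) (k + l) • tri u v (tri x y w)
  bs5 : ∀ i j k l x y u v, x ∈ g i → y ∈ g j → u ∈ g k → v ∈ g l →
    tri x y (mul u v) = sgn K k (i + j) • mul u (tri x y v) + mul (tri x y u) v
      + sgn K (i + j) (k + l) • tri u v (mul x y) + mul (mul x y) (mul u v)

variable {K B L : Type*} [Field K] [AddCommGroup B] [Module K B]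

/-- `P` is a pseudo superderivation of degree `r` of the Bol superalgebra `A`
with companion `a ∈ A.g r`. -/
def IsPSD (A : BolSuper K B) (r : ZMod 2) (P : B →ₗ[K] B) (a : B) : Prop :=
  a ∈ A.g r ∧
  (∀ i x, x ∈ A.g i → P x ∈ A.g (i + r)) ∧
  (∀ i j k x y z, x ∈ A.g i → y ∈ A.g j → z ∈ A.g k →
    P (A.tri x y z) = A.tri (P x) y z + sgn K r i • A.tri x (P y) z
      + sgn K r (i + j) • A.tri x y (P z)) ∧
  (∀ i j x y, x ∈ A.g i → y ∈ A.g j →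
    P (A.mul x y) = sgn K r i • A.mul x (P y) + A.mul (P x) y
      + sgn K r (i + j) • A.tri x y a + A.mul a (A.mul x y))

/-- The bracket on pairs (pseudo superderivation, companion), for degrees `r`, `s`. -/
def pbrk (A : BolSuper K B) (r s : ZMod 2)
    (pa qb : (B →ₗ[K] B) × B) : (B →ₗ[K] B) × B :=
  (pa.1 ∘ₗ qb.1 - sgn K r s • (qb.1 ∘ₗ pa.1),
   pa.1 qb.2 - sgn K r s • qb.1 pa.2 - A.mul pa.2 qb.2)

/-- The bracket on `B ⊕ H` (elements encoded as pairs `(x, (P, a))`),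
for degrees `r`, `s`. -/
def lbrk (A : BolSuper K B) (r s : ZMod 2)
    (u v : B × ((B →ₗ[K] B) × B)) : B × ((B →ₗ[K] B) × B) :=
  (u.2.1 v.1 - sgn K r s • v.2.1 u.1,
   (A.tri u.1 v.1 + (pbrk A r s u.2 v.2).1,
    A.mul u.1 v.1 + (pbrk A r s u.2 v.2).2))

/-- The degree-`r` part of the span of the inner pairs `(D_{x,u}, x·u)` with
`x` homogeneous in `B` and `u` homogeneous in the graded subspace `S`. -/
def IPSpan (A : BolSuper K B) (S : ZMod 2 → Submodule K B) (r : ZMod 2) :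
    Submodule K ((B →ₗ[K] B) × B) :=
  Submodule.span K {pa | ∃ i j x u, i + j = r ∧ x ∈ A.g i ∧ u ∈ S j ∧
    pa = (A.tri x u, A.mul x u)}

/-- Data presenting a Lie superalgebra `L` as the standard enveloping Lie
superalgebra `L(B) = B ⊕ IPS(B,B)` of the Bol superalgebra `A`, together with
the grading involution `sigma` used to define supertraces. -/
structure EnvSetup (K B L : Type*) [Field K] [AddCommGroup B] [Module K B]
    [AddCommGroup L] [Module K L] (A : BolSuper K B) where
  brk : L →ₗ[K] L →ₗ[K] L
  iota : B →ₗ[K] L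
  jmap : ((B →ₗ[K] B) × B) →ₗ[K] L
  gL : ZMod 2 → Submodule K L
  gL_eq : ∀ r, gL r = (A.g r).map iota ⊔ (IPSpan A A.g r).map jmap
  surj : ∀ v : L, ∃ x pa, pa ∈ IPSpan A A.g 0 ⊔ IPSpan A A.g 1 ∧ v = iota x + jmap pa
  inj : ∀ x pa, pa ∈ IPSpan A A.g 0 ⊔ IPSpan A A.g 1 → iota x + jmap pa = 0 →
    x = 0 ∧ pa = 0
  brk_bb : ∀ x y : B, brk (iota x) (iota y) = jmap (A.tri x y, A.mul x y)
  brk_pb : ∀ r pa, pa ∈ IPSpan A A.g r → ∀ x : B, brk (jmap pa) (iota x) = iota (pa.1 x)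
  brk_bp : ∀ r s x pa, x ∈ A.g r → pa ∈ IPSpan A A.g s →
    brk (iota x) (jmap pa) = -(sgn K r s • iota (pa.1 x))
  brk_pp : ∀ r s pa qb, pa ∈ IPSpan A A.g r → qb ∈ IPSpan A A.g s →
    brk (jmap pa) (jmap qb) = jmap (pbrk A r s pa qb)
  sigma : L →ₗ[K] L
  sigma0 : ∀ v ∈ gL 0, sigma v = v
  sigma1 : ∀ v ∈ gL 1, sigma v = -v

variable [AddCommGroup L] [Module K L]

/-- The Killing form `α(u,v) = str(ad u ∘ ad v)` of the enveloping Lie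
superalgebra, the supertrace being computed via the grading involution. -/
noncomputable def killing {A : BolSuper K B} (E : EnvSetup K B L A) (u v : L) : K :=
  LinearMap.trace K L (E.sigma ∘ₗ E.brk u ∘ₗ E.brk v)

/-- The Killing-Ricci form of `B`: the restriction of the Killing form of the
standard enveloping Lie superalgebra to `B × B`. -/
noncomputable def kr {A : BolSuper K B} (E : EnvSetup K B L A) (x y : B) : K :=
  killing E (E.iota x) (E.iota y)

theorem sgn_comm (K : Type*) [Field K] (i j : ZMod 2) : sgn K i j = sgn K j i := by
  rw [sgn, sgn, mul_comm]

theorem sgn_eq_one_or (K : Type*) [Field K] (i j : ZMod 2) :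
    sgn K i j = 1 ∨ sgn K i j = -1 :=
  neg_one_pow_eq_or K _

theorem sgn_mul_self (K : Type*) [Field K] (i j : ZMod 2) : sgn K i j * sgn K i j = 1 := by
  rcases sgn_eq_one_or K i j with h | h <;> simp [h]

theorem sgn_add_right (K : Type*) [Field K] (i j k : ZMod 2) :
    sgn K i (j + k) = sgn K i j * sgn K i k := by
  have parity : ∀ i j k : ZMod 2,
      (i * (j + k)).val % 2 = ((i * j).val + (i * k).val) % 2 := by decide
  rw [sgn, sgn, sgn, ← pow_add, neg_one_pow_eq_pow_mod_two, parity,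
    ← neg_one_pow_eq_pow_mod_two]

namespace BolSuper

variable (A : BolSuper K B) (b : B →ₗ[K] B →ₗ[K] K) {i j k l : ZMod 2} {x y z u : B}

theorem form_tri_swap (hx : x ∈ A.g i) (hy : y ∈ A.g j) (hz : z ∈ A.g k) :
    b (A.tri x y z) u = -(sgn K i j * b (A.tri y x z) u) := by
  rw [A.bs2 i j k x y z hx hy hz]
  simp

theorem form_tri_cyclic (hx : x ∈ A.g i) (hy : y ∈ A.g j) (hz : z ∈ A.g k) :
    b (A.tri x y z) u + sgn K i j * sgn K i k * b (A.tri y z x) u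
      + sgn K i k * sgn K j k * b (A.tri z x y) u = 0 := by
  have h := congrArg (fun v => b v u) (A.bs3 i j k x y z hx hy hz)
  simpa [sgn_add_right, sgn_comm K k i, sgn_comm K k j] using h

theorem form_tri_comm
    (hsym : ∀ (i j : ZMod 2) (x y : B), x ∈ A.g i → y ∈ A.g j → b x y = sgn K i j * b y x)
    (hx : x ∈ A.g i) (hy : y ∈ A.g j) (hz : z ∈ A.g k) (hu : u ∈ A.g l) :
    b u (A.tri x y z) = sgn K l i * sgn K l j * sgn K l k * b (A.tri x y z) u := by
  rw [hsym _ _ u _ hu (A.tri_mem i j k x y z hx hy hz), sgn_add_right, sgn_add_right]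

/-- Supersymmetry of the curvature-like form `b ([x, y, z], u)` under exchange of the pairs
`(x, y)` and `(z, u)`, when it is super skew-symmetric in its last two arguments. -/
theorem form_tri_pair_symm [CharZero K]
    (hskew : ∀ (i j k l : ZMod 2) (x y z u : B),
      x ∈ A.g i → y ∈ A.g j → z ∈ A.g k → u ∈ A.g l →
      b (A.tri x y z) u = -(sgn K k l * b (A.tri x y u) z))
    (hx : x ∈ A.g i) (hy : y ∈ A.g j) (hz : z ∈ A.g k) (hu : u ∈ A.g l) :
    b (A.tri x y z) u =
      sgn K i k * sgn K i l * sgn K j k * sgn K j l * b (A.tri z u x) y := by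
  have c1 := A.form_tri_cyclic b (u := u) hx hy hz
  have c2 := A.form_tri_cyclic b (u := x) hy hz hu
  have c3 := A.form_tri_cyclic b (u := y) hz hu hx
  have c4 := A.form_tri_cyclic b (u := z) hu hx hy
  rw [hskew _ _ _ _ _ _ _ _ hy hz hu hx, hskew _ _ _ _ _ _ _ _ hz hu hy hx,
    hskew _ _ _ _ _ _ _ _ hu hy hz hx, A.form_tri_swap b hu hy hx] at c2
  rw [A.form_tri_swap b hx hz hu, hskew _ _ _ _ _ _ _ _ hz hx hu hy] at c3
  rw [hskew _ _ _ _ _ _ _ _ hu hx hy hz, hskew _ _ _ _ _ _ _ _ hx hy hu hz] at c4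
  simp only [sgn_comm K l i, sgn_comm K l j, sgn_comm K l k, sgn_comm K k i,
    sgn_comm K j i] at c1 c2 c3 c4
  have h1 := sgn_mul_self K i j
  have h2 := sgn_mul_self K i k
  have h3 := sgn_mul_self K i l
  have h4 := sgn_mul_self K j k
  have h5 := sgn_mul_self K j l
  have h6 := sgn_mul_self K k l
  clear hskew hx hy hz hu
  generalize b (A.tri x y z) u = p, b (A.tri y z x) u = q, b (A.tri z x y) u = r,
    b (A.tri z u x) y = p', b (A.tri u x z) y = q', b (A.tri y u x) z = r' at *
  generalize sgn K i j = ij, sgn K i k = ik, sgn K i l = il, sgn K j k = jk,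
    sgn K j l = jl, sgn K k l = kl at *
  have key : 2 * p = 2 * (ik * il * jk * jl * p') := by
    linear_combination (norm := skip)
      c1 + ij * ik * il * c2 - ik * il * jk * jl * c3 - il * jl * kl * c4
    clear c1 c2 c3 c4
    grind
  exact mul_left_cancel₀ two_ne_zero key

end BolSuper

/-- for a supersymmetric bilinear form `b` on a Bol superalgebra,
the three invariance conditions (i), (ii), (iii) are equivalent. -/
theorem stmt9 {K B : Type*} [Field K] [CharZero K] [AddCommGroup B] [Module K B]
    (A : BolSuper K B) (b : B →ₗ[K] B →ₗ[K] K)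
    (hsym : ∀ (i j : ZMod 2) (x y : B), x ∈ A.g i → y ∈ A.g j →
      b x y = sgn K i j * b y x) :
    ((∀ (i j k l : ZMod 2) (x y z u : B),
        x ∈ A.g i → y ∈ A.g j → z ∈ A.g k → u ∈ A.g l →
        b (A.tri x y z) u = -(sgn K k (i + j) * b z (A.tri x y u))) ↔
     (∀ (i j k l : ZMod 2) (x y z u : B),
        x ∈ A.g i → y ∈ A.g j → z ∈ A.g k → u ∈ A.g l →
        b (A.tri x y z) u = -(sgn K j (k + l) * b x (A.tri z u y)))) ∧
    ((∀ (i j k l : ZMod 2) (x y z u : B),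
        x ∈ A.g i → y ∈ A.g j → z ∈ A.g k → u ∈ A.g l →
        b (A.tri x y z) u = -(sgn K j (k + l) * b x (A.tri z u y))) ↔
     (∀ (i j k l : ZMod 2) (x y z u : B),
        x ∈ A.g i → y ∈ A.g j → z ∈ A.g k → u ∈ A.g l →
        b x (A.tri y z u) = (sgn K i j * sgn K k l) * b y (A.tri x u z))) := by
  have skew_iff : (∀ (i j k l : ZMod 2) (x y z u : B),
        x ∈ A.g i → y ∈ A.g j → z ∈ A.g k → u ∈ A.g l →
        b (A.tri x y z) u = -(sgn K k (i + j) * b z (A.tri x y u))) ↔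
      (∀ (i j k l : ZMod 2) (x y z u : B),
        x ∈ A.g i → y ∈ A.g j → z ∈ A.g k → u ∈ A.g l →
        b (A.tri x y z) u = -(sgn K k l * b (A.tri x y u) z)) := by
    refine forall₄_congr fun i j k l => forall₄_congr fun x y z u =>
      forall₄_congr fun hx hy hz hu => ?_
    rw [A.form_tri_comm b hsym hx hy hu hz, sgn_add_right]
    have h1 := sgn_mul_self K k i
    have h2 := sgn_mul_self K k j
    generalize b (A.tri x y z) u = p, b (A.tri x y u) z = q, sgn K k i = ki,
      sgn K k j = kj, sgn K k l = kl at *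
    grind
  have exch_iff : (∀ (i j k l : ZMod 2) (x y z u : B),
        x ∈ A.g i → y ∈ A.g j → z ∈ A.g k → u ∈ A.g l →
        b (A.tri x y z) u = -(sgn K j (k + l) * b x (A.tri z u y))) ↔
      (∀ (i j k l : ZMod 2) (x y z u : B),
        x ∈ A.g i → y ∈ A.g j → z ∈ A.g k → u ∈ A.g l →
        b (A.tri x y z) u = -(sgn K i j * sgn K i k * sgn K i l * sgn K j k * sgn K j l *
          b (A.tri z u y) x)) := by
    refine forall₄_congr fun i j k l => forall₄_congr fun x y z u =>
      forall₄_congr fun hx hy hz hu => ?_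
    rw [A.form_tri_comm b hsym hz hu hy hx, sgn_add_right]
    ring_nf
  rw [skew_iff, exch_iff]
  refine ⟨⟨fun h i j k l x y z u hx hy hz hu => ?_,
    fun h i j k l x y z u hx hy hz hu => ?_⟩,
    ⟨fun h i j k l x y z u hx hy hz hu => ?_, fun h i j k l x y z u hx hy hz hu => ?_⟩⟩
  · rw [A.form_tri_pair_symm b h hx hy hz hu, h _ _ _ _ _ _ _ _ hz hu hx hy]
    ring
  · rw [h _ _ _ _ _ _ _ _ hx hy hz hu, h _ _ _ _ _ _ _ _ hz hu hy hx,
      A.form_tri_swap b hy hx hu]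
    simp only [sgn_comm K l i, sgn_comm K l j, sgn_comm K k i,
      sgn_comm K k j, sgn_comm K j i]
    have h1 := sgn_mul_self K i j
    have h2 := sgn_mul_self K i k
    have h3 := sgn_mul_self K i l
    have h4 := sgn_mul_self K j k
    have h5 := sgn_mul_self K j l
    have h6 := sgn_mul_self K k l
    clear h hsym skew_iff exch_iff
    grind
  · rw [A.form_tri_comm b hsym hy hz hu hx, A.form_tri_comm b hsym hx hu hz hy,
      h _ _ _ _ _ _ _ _ hy hz hu hx, A.form_tri_swap b hu hx hz]
    simp only [sgn_comm K l i, sgn_comm K k i, sgn_comm K j i]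
    have h1 := sgn_mul_self K i j
    have h2 := sgn_mul_self K i k
    have h3 := sgn_mul_self K i l
    have h4 := sgn_mul_self K j k
    have h5 := sgn_mul_self K j l
    have h6 := sgn_mul_self K k l
    clear h hsym skew_iff exch_iff
    grind
  · have e := h _ _ _ _ _ _ _ _ hu hx hy hz
    rw [A.form_tri_comm b hsym hx hy hz hu, A.form_tri_comm b hsym hu hz hy hx,
      A.form_tri_swap b hu hz hy] at e
    simp only [sgn_comm K l i, sgn_comm K l j, sgn_comm K l k] at e ⊢
    have h1 := sgn_mul_self K i j
    have h2 := sgn_mul_self K i k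
    have h3 := sgn_mul_self K i l
    have h4 := sgn_mul_self K j k
    have h5 := sgn_mul_self K j l
    have h6 := sgn_mul_self K k l
    clear h hsym skew_iff exch_iff
    grind
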